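/- arXiv:2205.13981 — 3 statements merged into one kernel-verified Lean document; each statement's English description precedes it below -/
import Mathlib

section
/- Let p be an odd prime, α, β : ℕ, and let 𝒞 be an additive subgroup of (Fin α → ZMod p) × (Fin β → ZMod (p²)). Then the image set C = Φ '' 𝒞 is a linear code (i.e. C is closed under addition, equivalently C is the carrier of a ZMod p-submodule of (Fin α → ZMod p) × (Fin β → Fin p → ZMod p)) if and only if pP(u,v) ∈ 𝒞 for all u, v ∈ 𝒞. -/
/-- The Gray map `φ : ZMod (p²) → (Fin p → ZMod p)`. -/
def gray (p : ℕ) (θ : ZMod (p ^ 2)) : Fin p → ZMod p :=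
  fun i => ((θ.val / p : ℕ) : ZMod p) + ((θ.val % p : ℕ) : ZMod p) * ((i : ℕ) : ZMod p)

/-- The extended Gray map `Φ`. -/
def Gray (p α β : ℕ) (u : (Fin α → ZMod p) × (Fin β → ZMod (p ^ 2))) :
    (Fin α → ZMod p) × (Fin β → Fin p → ZMod p) :=
  (u.1, fun j => gray p (u.2 j))

/-- The carry `c(u,v)`. -/
def carry (p : ℕ) (u v : ZMod (p ^ 2)) : ℕ :=
  if p ≤ u.val % p + v.val % p then 1 else 0

/-- `pP(u,v)`. -/
def pP (p α β : ℕ) (u v : (Fin α → ZMod p) × (Fin β → ZMod (p ^ 2))) :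
    (Fin α → ZMod p) × (Fin β → ZMod (p ^ 2)) :=
  (0, fun j => (p : ZMod (p ^ 2)) * ((carry p (u.2 j) (v.2 j) : ℕ) : ZMod (p ^ 2)))

theorem gray_natCast (p : ℕ) (hp : p.Prime) (n : ℕ) (i : Fin p) :
    gray p (n : ZMod (p ^ 2)) i =
      ((n / p : ℕ) : ZMod p) + ((n % p : ℕ) : ZMod p) * ((i : ℕ) : ZMod p) := by
  unfold gray
  rw [ZMod.val_natCast, pow_two, Nat.mod_mul_right_div_self, Nat.mod_mul_right_mod,
    ZMod.natCast_mod]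

theorem gray_add (p : ℕ) (hp : p.Prime) (u v : ZMod (p ^ 2)) :
    gray p (u + v - (p : ZMod (p ^ 2)) * ((carry p u v : ℕ) : ZMod (p ^ 2))) =
      gray p u + gray p v := by
  haveI : NeZero (p ^ 2) := ⟨pow_ne_zero 2 hp.ne_zero⟩
  have hpos := hp.pos
  set a := u.val with ha
  set b := v.val with hb
  have h1 : p * (a / p + b / p) + (a % p + b % p) % p + p * carry p u v = a + b := by
    have e1 := Nat.div_add_mod a p
    have e2 := Nat.div_add_mod b p
    have l1 := Nat.mod_lt a hpos
    have l2 := Nat.mod_lt b hpos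
    unfold carry
    rw [← ha, ← hb, mul_add]
    split_ifs with h
    · rw [Nat.mod_eq_sub_mod h, Nat.mod_eq_of_lt (by omega)]
      omega
    · rw [Nat.mod_eq_of_lt (by omega)]
      omega
  have h2 : u + v - (p : ZMod (p ^ 2)) * ((carry p u v : ℕ) : ZMod (p ^ 2)) =
      ((p * (a / p + b / p) + (a % p + b % p) % p : ℕ) : ZMod (p ^ 2)) := by
    have h3 := congrArg (Nat.cast : ℕ → ZMod (p ^ 2)) h1
    rw [Nat.cast_add, Nat.cast_mul p (carry p u v), Nat.cast_add a b, ha, hb,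
      ZMod.natCast_zmod_val, ZMod.natCast_zmod_val] at h3
    rw [← h3, add_sub_cancel_right]
  rw [h2]
  funext i
  rw [gray_natCast p hp]
  have l := Nat.mod_lt (a % p + b % p) hpos
  rw [Nat.mul_add_div hpos, Nat.div_eq_of_lt l, Nat.mul_add_mod, Nat.mod_mod,
    ZMod.natCast_mod]
  simp only [Pi.add_apply, gray, ← ha, ← hb]
  push_cast
  ring

theorem gray_injective (p : ℕ) (hp : p.Prime) : Function.Injective (gray p) := by
  haveI : NeZero (p ^ 2) := ⟨pow_ne_zero 2 hp.ne_zero⟩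
  intro u v h
  have h0 := congrFun h ⟨0, hp.pos⟩
  have h1 := congrFun h ⟨1, hp.one_lt⟩
  simp only [gray, Nat.cast_zero, mul_zero, add_zero, Nat.cast_one, mul_one] at h0 h1
  rw [h0] at h1
  have h1 := add_left_cancel h1
  rw [ZMod.natCast_eq_natCast_iff'] at h0 h1
  have lu : u.val / p < p := Nat.div_lt_of_lt_mul ((ZMod.val_lt u).trans_eq (pow_two p))
  have lv : v.val / p < p := Nat.div_lt_of_lt_mul ((ZMod.val_lt v).trans_eq (pow_two p))
  rw [Nat.mod_eq_of_lt lu, Nat.mod_eq_of_lt lv] at h0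
  rw [Nat.mod_mod, Nat.mod_mod] at h1
  apply ZMod.val_injective
  rw [← Nat.div_add_mod u.val p, ← Nat.div_add_mod v.val p, h0, h1]

theorem Gray_add (p α β : ℕ) (hp : p.Prime)
    (u v : (Fin α → ZMod p) × (Fin β → ZMod (p ^ 2))) :
    Gray p α β (u + v - pP p α β u v) = Gray p α β u + Gray p α β v := by
  refine Prod.ext ?_ ?_
  · simp [Gray, pP]
  · funext j
    exact gray_add p hp (u.2 j) (v.2 j)

theorem Gray_injective (p α β : ℕ) (hp : p.Prime) : Function.Injective (Gray p α β) := by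
  intro u v h
  have h1 : (Gray p α β u).1 = (Gray p α β v).1 := by rw [h]
  refine Prod.ext h1 ?_
  funext j
  exact gray_injective p hp (congrFun (congrArg Prod.snd h) j)

theorem Gray_zero (p α β : ℕ) : Gray p α β 0 = 0 := by
  refine Prod.ext rfl ?_
  funext j i
  simp [Gray, gray]

/-- The Gray image `C = Φ '' 𝒞` of a `Z_pZ_{p²}`-additive code `𝒞` is linear
(the carrier of a `ZMod p`-submodule) iff `pP(u,v) ∈ 𝒞` for all `u, v ∈ 𝒞`. -/
theorem GrayImage_linear_iff (p : ℕ) (hp : p.Prime) (hodd : Odd p) (α β : ℕ)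
    (𝒞 : AddSubgroup ((Fin α → ZMod p) × (Fin β → ZMod (p ^ 2)))) :
    (∃ S : Submodule (ZMod p) ((Fin α → ZMod p) × (Fin β → Fin p → ZMod p)),
        (S : Set ((Fin α → ZMod p) × (Fin β → Fin p → ZMod p))) =
          Gray p α β '' (𝒞 : Set ((Fin α → ZMod p) × (Fin β → ZMod (p ^ 2))))) ↔
      ∀ u ∈ 𝒞, ∀ v ∈ 𝒞, pP p α β u v ∈ 𝒞 := by
  constructor
  · rintro ⟨S, hS⟩ u hu v hv
    have mem : ∀ w, w ∈ 𝒞 → Gray p α β w ∈ S := fun w hw => by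
      rw [← SetLike.mem_coe, hS]
      exact ⟨w, hw, rfl⟩
    have h := S.add_mem (mem u hu) (mem v hv)
    rw [← Gray_add p α β hp, ← SetLike.mem_coe, hS] at h
    obtain ⟨w, hw, e⟩ := h
    have e := Gray_injective p α β hp e
    have h2 : pP p α β u v = u + v - w := by rw [e]; abel
    rw [h2]
    exact 𝒞.sub_mem (𝒞.add_mem hu hv) hw
  · intro H
    haveI : NeZero p := ⟨hp.ne_zero⟩
    let M : AddSubmonoid ((Fin α → ZMod p) × (Fin β → Fin p → ZMod p)) :=
      { carrier := Gray p α β '' (𝒞 : Set ((Fin α → ZMod p) × (Fin β → ZMod (p ^ 2))))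
        zero_mem' := ⟨0, 𝒞.zero_mem, Gray_zero p α β⟩
        add_mem' := by
          rintro _ _ ⟨u, hu, rfl⟩ ⟨v, hv, rfl⟩
          exact ⟨_, 𝒞.sub_mem (𝒞.add_mem hu hv) (H u hu v hv), Gray_add p α β hp u v⟩ }
    refine ⟨{ M with smul_mem' := ?_ }, rfl⟩
    intro c x hx
    have h : c • x = c.val • x := by
      conv_lhs => rw [← ZMod.natCast_zmod_val c]
      exact Nat.cast_smul_eq_nsmul _ _ _
    rw [h]
    exact M.nsmul_mem hx _
end

section
/- Let α, β, γ, δ : ℕ and let 𝒞 be the additive subgroup of (Fin α → ZMod 3) × (Fin β → ZMod 9) generated by elements u₁, …, u_γ with 3 • uᵢ = 0 and elements v₁, …, v_δ. Then the ZMod 3-linear span of the Gray image Φ '' 𝒞 equals the ZMod 3-linear span of the finite set {Φ(uᵢ) : 1 ≤ i ≤ γ} ∪ {Φ(vⱼ) : 1 ≤ j ≤ δ} ∪ {Φ(3 • (v_k ∗ v_l)) : 1 ≤ l ≤ k ≤ δ} ∪ {Φ(3 • (v_x ∗ v_y ∗ v_z)) : 1 ≤ x ≤ y ≤ z ≤ δ},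 where ∗ denotes componentwise multiplication on each factor. -/
/-- The Gray map `φ : ZMod 9 → (Fin 3 → ZMod 3)`. -/
def gray3 (θ : ZMod 9) : Fin 3 → ZMod 3 :=
  fun i => ((θ.val / 3 : ℕ) : ZMod 3) + ((θ.val % 3 : ℕ) : ZMod 3) * ((i : ℕ) : ZMod 3)

/-- The extended Gray map `Φ`. -/
def Gray3 (α β : ℕ) (u : (Fin α → ZMod 3) × (Fin β → ZMod 9)) :
    (Fin α → ZMod 3) × (Fin β → Fin 3 → ZMod 3) :=
  (u.1, fun j => gray3 (u.2 j))

/-- The kernel `K(C) = {x : x + C = C}` of a subset `C`. -/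
def kernelSet {V : Type*} [AddCommGroup V] (C : Set V) : Set V :=
  {x | (fun c => x + c) '' C = C}

theorem gray3_three_add (a b : ZMod 9) :
    gray3 (3 • (a + b)) = gray3 (3 • a) + gray3 (3 • b) := by
  revert a b; decide

theorem gray3_add (a b : ZMod 9) :
    gray3 (a + b) = gray3 a + gray3 b -
      (gray3 (3 • (a * b)) + gray3 (3 • (a * a * b)) + gray3 (3 • (a * b * b))) := by
  revert a b; decide

/-- The additive map `x ↦ Φ(3x)`. -/
def psi3 (α β : ℕ) : ((Fin α → ZMod 3) × (Fin β → ZMod 9)) →+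
    (Fin α → ZMod 3) × (Fin β → Fin 3 → ZMod 3) :=
  AddMonoidHom.mk' (fun x => Gray3 α β ((3 : ℕ) • x)) (by
    intro a b
    refine Prod.ext ?_ ?_
    · simp [Gray3]
    · funext j
      exact gray3_three_add _ _)

theorem psi3_apply (α β : ℕ) (x) : psi3 α β x = Gray3 α β ((3 : ℕ) • x) := rfl

theorem three_zmod3 : (3 : ZMod 3) = 0 := by decide

theorem Gray3_add (α β : ℕ) (a b : (Fin α → ZMod 3) × (Fin β → ZMod 9)) :
    Gray3 α β (a + b) = Gray3 α β a + Gray3 α β b -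
      (psi3 α β (a * b) + psi3 α β (a * a * b) + psi3 α β (a * b * b)) := by
  refine Prod.ext ?_ ?_
  · funext j
    simp [psi3_apply, Gray3, three_zmod3]
  · funext j
    exact gray3_add _ _

theorem Gray3_zero (α β : ℕ) : Gray3 α β 0 = 0 := by
  refine Prod.ext rfl ?_
  funext j
  show gray3 0 = 0
  decide

theorem psi3_mul_of_three (α β : ℕ) (a b : (Fin α → ZMod 3) × (Fin β → ZMod 9))
    (h : 3 • a = 0) : psi3 α β (a * b) = 0 := by
  rw [psi3_apply, ← smul_mul_assoc, h, zero_mul, Gray3_zero]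

section
variable {α β : ℕ} (C : AddSubgroup ((Fin α → ZMod 3) × (Fin β → ZMod 9)))
  (W : Submodule (ZMod 3) ((Fin α → ZMod 3) × (Fin β → Fin 3 → ZMod 3)))

theorem half_mem {x : (Fin α → ZMod 3) × (Fin β → Fin 3 → ZMod 3)} (h : x + x ∈ W) : x ∈ W := by
  have h2 := W.smul_mem (2 : ZMod 3) h
  have e : (2 : ZMod 3) • (x + x) = x := by
    rw [← two_smul (ZMod 3) x, smul_smul]
    have : (2 * 2 : ZMod 3) = 1 := by decide
    rw [this, one_smul]
  rwa [e] at h2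

theorem psi_T (hW : ∀ x ∈ C, Gray3 α β x ∈ W) {a b} (ha : a ∈ C) (hb : b ∈ C) :
    psi3 α β (a * b) + psi3 α β (a * a * b) + psi3 α β (a * b * b) ∈ W := by
  have h := W.sub_mem (W.add_mem (hW a ha) (hW b hb)) (hW _ (C.add_mem ha hb))
  rw [Gray3_add] at h
  simpa using h

theorem psi_abb (hW : ∀ x ∈ C, Gray3 α β x ∈ W) {a b} (ha : a ∈ C) (hb : b ∈ C) :
    psi3 α β (a * b * b) ∈ W := by
  have h := W.add_mem (psi_T C W hW ha hb) (psi_T C W hW ha (C.neg_mem hb))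
  apply half_mem W
  convert h using 1
  simp only [mul_neg, neg_mul, neg_neg, map_neg]
  abel

theorem psi_ab (hW : ∀ x ∈ C, Gray3 α β x ∈ W) {a b} (ha : a ∈ C) (hb : b ∈ C) :
    psi3 α β (a * b) ∈ W := by
  have h := psi_T C W hW ha hb
  have h1 := psi_abb C W hW ha hb
  have h2 := psi_abb C W hW hb ha
  have e : b * a * a = a * a * b := by ring
  rw [e] at h2
  have := W.sub_mem (W.sub_mem h h1) h2
  convert this using 1
  abel

theorem psi_abc (hW : ∀ x ∈ C, Gray3 α β x ∈ W) {a b c} (ha : a ∈ C) (hb : b ∈ C)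
    (hc : c ∈ C) : psi3 α β (a * b * c) ∈ W := by
  have h := psi_abb C W hW ha (C.add_mem hb hc)
  have h1 := psi_abb C W hW ha hb
  have h2 := psi_abb C W hW ha hc
  have e : a * (b + c) * (b + c) = a * b * b + a * c * c + (a * b * c + a * b * c) := by ring
  rw [e, map_add, map_add, map_add] at h
  apply half_mem W
  have := W.sub_mem h (W.add_mem h1 h2)
  convert this using 1
  abel

/-- Closure induction for an additive map. -/
theorem closure_hom_mem {s : Set ((Fin α → ZMod 3) × (Fin β → ZMod 9))}
    (f : ((Fin α → ZMod 3) × (Fin β → ZMod 9)) →+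
      (Fin α → ZMod 3) × (Fin β → Fin 3 → ZMod 3))
    (h : ∀ x ∈ s, f x ∈ W) {x} (hx : x ∈ AddSubgroup.closure s) : f x ∈ W := by
  have : AddSubgroup.closure s ≤ W.toAddSubgroup.comap f := by
    rw [AddSubgroup.closure_le]
    exact h
  exact this hx

theorem closure_two {s : Set ((Fin α → ZMod 3) × (Fin β → ZMod 9))}
    (h : ∀ x ∈ s, ∀ y ∈ s, psi3 α β (x * y) ∈ W) {x y} (hx : x ∈ AddSubgroup.closure s)
    (hy : y ∈ AddSubgroup.closure s) : psi3 α β (x * y) ∈ W := by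
  refine closure_hom_mem W ((psi3 α β).comp (AddMonoidHom.mulRight y)) (fun a ha => ?_) hx
  exact closure_hom_mem W ((psi3 α β).comp (AddMonoidHom.mulLeft a)) (fun b hb => h a ha b hb) hy

theorem closure_three {s : Set ((Fin α → ZMod 3) × (Fin β → ZMod 9))}
    (h : ∀ x ∈ s, ∀ y ∈ s, ∀ z ∈ s, psi3 α β (x * y * z) ∈ W) {x y z}
    (hx : x ∈ AddSubgroup.closure s)
    (hy : y ∈ AddSubgroup.closure s) (hz : z ∈ AddSubgroup.closure s) :
    psi3 α β (x * y * z) ∈ W := by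
  refine closure_hom_mem W ((psi3 α β).comp (AddMonoidHom.mulLeft (x * y))) (fun c hc => ?_) hz
  refine closure_hom_mem W (((psi3 α β).comp (AddMonoidHom.mulRight c)).comp
    (AddMonoidHom.mulRight y)) (fun a ha => ?_) hx
  exact closure_hom_mem W (((psi3 α β).comp (AddMonoidHom.mulRight c)).comp
    (AddMonoidHom.mulLeft a)) (fun b hb => h a ha b hb c hc) hy
end

/-- The linear span of `Φ '' 𝒞`, for `𝒞` generated by order-3 elements `uᵢ` and
elements `vⱼ`, is spanned by `Φ(uᵢ)`, `Φ(vⱼ)`, `Φ(3(v_k ∗ v_l))` for `l ≤ k`, and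
`Φ(3(v_x ∗ v_y ∗ v_z))` for `x ≤ y ≤ z`. -/
theorem span_GrayImage (α β γ δ : ℕ)
    (u : Fin γ → (Fin α → ZMod 3) × (Fin β → ZMod 9))
    (v : Fin δ → (Fin α → ZMod 3) × (Fin β → ZMod 9))
    (hu : ∀ i, 3 • u i = 0)
    (𝒞 : AddSubgroup ((Fin α → ZMod 3) × (Fin β → ZMod 9)))
    (h𝒞 : 𝒞 = AddSubgroup.closure (Set.range u ∪ Set.range v)) :
    Submodule.span (ZMod 3) (Gray3 α β '' (𝒞 : Set ((Fin α → ZMod 3) × (Fin β → ZMod 9)))) =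
      Submodule.span (ZMod 3)
        ((Set.range fun i => Gray3 α β (u i)) ∪
          (Set.range fun j => Gray3 α β (v j)) ∪
          {w | ∃ k l : Fin δ, l ≤ k ∧ w = Gray3 α β ((3 : ℕ) • (v k * v l))} ∪
          {w | ∃ x y z : Fin δ, x ≤ y ∧ y ≤ z ∧
            w = Gray3 α β ((3 : ℕ) • (v x * v y * v z))}) := by
  subst h𝒞
  apply le_antisymm
  · rw [Submodule.span_le]
    set W := Submodule.span (ZMod 3)
        ((Set.range fun i => Gray3 α β (u i)) ∪
          (Set.range fun j => Gray3 α β (v j)) ∪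
          {w | ∃ k l : Fin δ, l ≤ k ∧ w = Gray3 α β ((3 : ℕ) • (v k * v l))} ∪
          {w | ∃ x y z : Fin δ, x ≤ y ∧ y ≤ z ∧
            w = Gray3 α β ((3 : ℕ) • (v x * v y * v z))}) with hWdef
    have hWu : ∀ i, Gray3 α β (u i) ∈ W := fun i =>
      Submodule.subset_span (Or.inl (Or.inl (Or.inl ⟨i, rfl⟩)))
    have hWv : ∀ i, Gray3 α β (v i) ∈ W := fun i =>
      Submodule.subset_span (Or.inl (Or.inl (Or.inr ⟨i, rfl⟩)))
    have h2' : ∀ k l, l ≤ k → psi3 α β (v k * v l) ∈ W := fun k l h =>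
      Submodule.subset_span (Or.inl (Or.inr ⟨k, l, h, rfl⟩))
    have h3' : ∀ x y z, x ≤ y → y ≤ z → psi3 α β (v x * v y * v z) ∈ W := fun x y z h h' =>
      Submodule.subset_span (Or.inr ⟨x, y, z, h, h', rfl⟩)
    have h2v : ∀ k l, psi3 α β (v k * v l) ∈ W := by
      intro k l
      rcases le_total l k with h | h
      · exact h2' k l h
      · rw [mul_comm]; exact h2' l k h
    have h3v : ∀ x y z, psi3 α β (v x * v y * v z) ∈ W := by
      intro x y z
      rcases le_total x y with h | h <;> rcases le_total y z with h' | h' <;>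
        rcases le_total x z with h'' | h''
      · exact h3' x y z h h'
      · exact h3' x y z h h'
      · rw [show v x * v y * v z = v x * v z * v y by ring]; exact h3' x z y h'' h'
      · rw [show v x * v y * v z = v z * v x * v y by ring]; exact h3' z x y h'' h
      · rw [show v x * v y * v z = v y * v x * v z by ring]; exact h3' y x z h h''
      · rw [show v x * v y * v z = v y * v z * v x by ring]; exact h3' y z x h' h''
      · rw [show v x * v y * v z = v z * v y * v x by ring]; exact h3' z y x h' h
      · rw [show v x * v y * v z = v z * v y * v x by ring]; exact h3' z y x h' h
    have hz : ∀ i b, psi3 α β (u i * b) ∈ W := fun i b => by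
      rw [psi3_mul_of_three α β _ _ (hu i)]; exact W.zero_mem
    have h2 : ∀ x ∈ AddSubgroup.closure (Set.range u ∪ Set.range v),
        ∀ y ∈ AddSubgroup.closure (Set.range u ∪ Set.range v), psi3 α β (x * y) ∈ W := by
      intro x hx y hy
      refine closure_two W ?_ hx hy
      rintro _ (⟨i, rfl⟩ | ⟨i, rfl⟩) _ (⟨j, rfl⟩ | ⟨j, rfl⟩)
      · exact hz _ _
      · exact hz _ _
      · rw [mul_comm]; exact hz _ _
      · exact h2v _ _
    have h3 : ∀ x ∈ AddSubgroup.closure (Set.range u ∪ Set.range v),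
        ∀ y ∈ AddSubgroup.closure (Set.range u ∪ Set.range v),
        ∀ z ∈ AddSubgroup.closure (Set.range u ∪ Set.range v), psi3 α β (x * y * z) ∈ W := by
      intro x hx y hy z hz'
      refine closure_three W ?_ hx hy hz'
      rintro _ (⟨i, rfl⟩ | ⟨i, rfl⟩) b hb c hc
      · rw [mul_assoc]; exact hz _ _
      rcases hb with ⟨j, rfl⟩ | ⟨j, rfl⟩
      · rw [mul_comm (v i), mul_assoc]; exact hz _ _
      rcases hc with ⟨k, rfl⟩ | ⟨k, rfl⟩
      · rw [mul_comm]; exact hz _ _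
      · exact h3v _ _ _
    rintro _ ⟨x, hx, rfl⟩
    change Gray3 α β x ∈ W
    have hx' : x ∈ AddSubgroup.closure (Set.range u ∪ Set.range v) := hx
    clear hx
    induction hx' using AddSubgroup.closure_induction with
    | mem x hx =>
      rcases hx with ⟨i, rfl⟩ | ⟨i, rfl⟩
      · exact hWu i
      · exact hWv i
    | zero => rw [Gray3_zero]; exact W.zero_mem
    | add a b ha hb iha ihb =>
      rw [Gray3_add]
      exact W.sub_mem (W.add_mem iha ihb) (W.add_mem (W.add_mem (h2 a ha b hb)
        (h3 a ha a ha b hb)) (h3 a ha b hb b hb))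
    | neg a ha iha =>
      have hn := AddSubgroup.neg_mem _ ha
      have e := Gray3_add α β a (-a)
      rw [add_neg_cancel, Gray3_zero] at e
      have hT := W.add_mem (W.add_mem (h2 a ha _ hn) (h3 a ha a ha _ hn)) (h3 a ha _ hn _ hn)
      have := W.sub_mem hT iha
      convert this using 1
      rw [eq_comm, sub_eq_zero] at e
      rw [← e]
      abel
  · set W := Submodule.span (ZMod 3) (Gray3 α β ''
      (AddSubgroup.closure (Set.range u ∪ Set.range v) :
        Set ((Fin α → ZMod 3) × (Fin β → ZMod 9)))) with hWdef
    have hW : ∀ x ∈ AddSubgroup.closure (Set.range u ∪ Set.range v), Gray3 α β x ∈ W :=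
      fun x hx => Submodule.subset_span ⟨x, hx, rfl⟩
    have hum : ∀ i, u i ∈ AddSubgroup.closure (Set.range u ∪ Set.range v) := fun i =>
      AddSubgroup.subset_closure (Or.inl ⟨i, rfl⟩)
    have hvm : ∀ i, v i ∈ AddSubgroup.closure (Set.range u ∪ Set.range v) := fun i =>
      AddSubgroup.subset_closure (Or.inr ⟨i, rfl⟩)
    rw [Submodule.span_le]
    rintro _ (((⟨i, rfl⟩ | ⟨i, rfl⟩) | ⟨k, l, _, rfl⟩) | ⟨x, y, z, _, _, rfl⟩)
    · exact hW _ (hum i)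
    · exact hW _ (hvm i)
    · exact psi_ab _ W hW (hvm k) (hvm l)
    · exact psi_abc _ W hW (hvm x) (hvm y) (hvm z)
end

section
/- Let α, β, γ, δ, κ be natural numbers satisfying α + β > 0, 0 < γ + δ ≤ β + κ, and κ ≤ min(α, γ). Let 𝒞 be an additive subgroup of (Fin α → ZMod 3) × (Fin β → ZMod 9) with 𝒞 ≃+ (Fin γ → ZMod 3) × (Fin δ → ZMod 9) as additive groups, such that the ZMod 3-dimension of the projection onto the first α coordinates of the order-3 subcode {u ∈ 𝒞 : 3 • u = 0} equals κ. Let C = Φ '' 𝒞 and rank(C) = Module.finrank (ZMod 3) (Submodule.span (ZMod 3) C). Then γ + 2δ ≤ rank(C) ≤ γ + 2δ + min(β − (γ − κ) − δ, choose(δ+1, 2) + choose(δ+2, 3) − δ), i.e. writing rank(C) = γ + 2δ + r̄ one has 0 ≤ r̄ ≤ min(β − (γ − κ) − δ, choose(δ+1, 2) + choose(δ+2, 3) − δ). -/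
/-- The parameter `κ`: the `ZMod 3`-dimension of the projection onto the first `α`
coordinates of the order-3 subcode of `𝒞`. -/
noncomputable def kappa3 (α β : ℕ)
    (𝒞 : AddSubgroup ((Fin α → ZMod 3) × (Fin β → ZMod 9))) : ℕ :=
  Module.finrank (ZMod 3)
    (Submodule.span (ZMod 3)
      (Prod.fst '' {u : (Fin α → ZMod 3) × (Fin β → ZMod 9) | u ∈ 𝒞 ∧ 3 • u = 0}))

open scoped Pointwise in
/-- dimension of the powers of a span -/
lemma finrank_span_pow_le {R : Type*} [CommRing R] [Algebra (ZMod 3) R] (δ k : ℕ) (l : Fin δ → R) :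
    Module.finrank (ZMod 3) ((Submodule.span (ZMod 3) (Set.range l)) ^ k : Submodule (ZMod 3) R)
      ≤ Nat.multichoose δ k := by
  classical
  rw [Submodule.span_pow]
  let m : Sym (Fin δ) k → R := fun s => ((s : Multiset (Fin δ)).map l).prod
  have hsub : (Set.range l) ^ k ⊆ Set.range m := by
    intro a ha
    rw [Set.mem_pow] at ha
    obtain ⟨f, rfl⟩ := ha
    choose g hg using fun i => (f i).2
    refine ⟨Sym.mk (Multiset.ofList (List.ofFn g)) (by simp), ?_⟩
    simp only [m, Sym.coe_mk, Multiset.map_coe, Multiset.prod_coe, List.map_ofFn]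
    congr 2
    funext i
    exact hg i
  have : Module.Finite (ZMod 3) (Submodule.span (ZMod 3) (Set.range m)) :=
    Module.Finite.span_of_finite _ (Set.finite_range m)
  calc _ ≤ Module.finrank (ZMod 3) (Submodule.span (ZMod 3) (Set.range m)) :=
        Submodule.finrank_mono (Submodule.span_mono hsub)
    _ ≤ Fintype.card (Sym (Fin δ) k) := finrank_range_le_card m
    _ = _ := by rw [Sym.card_sym_fin_eq_multichoose]

lemma finrank_span_range_le {X A B C : Type*} [Finite X] [Finite A] [Finite B] [Finite C]
    (F : X → (A → ZMod 3) × (B → C → ZMod 3)) (W : Submodule (ZMod 3) (X → ZMod 3))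
    (hA : ∀ a, (fun x => (F x).1 a) ∈ W) (hB : ∀ b c, (fun x => (F x).2 b c) ∈ W) :
    Module.finrank (ZMod 3) (Submodule.span (ZMod 3) (Set.range F)) ≤
      Module.finrank (ZMod 3) W := by
  let Ev : Module.Dual (ZMod 3) W →ₗ[ZMod 3] (A → ZMod 3) × (B → C → ZMod 3) :=
    { toFun := fun ξ => (fun a => ξ ⟨_, hA a⟩, fun b c => ξ ⟨_, hB b c⟩)
      map_add' := fun _ _ => rfl
      map_smul' := fun _ _ => rfl }
  have hle : Submodule.span (ZMod 3) (Set.range F) ≤ LinearMap.range Ev := by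
    rw [Submodule.span_le]
    rintro _ ⟨x, rfl⟩
    exact ⟨(LinearMap.proj x : (X → ZMod 3) →ₗ[ZMod 3] ZMod 3).comp W.subtype, rfl⟩
  calc _ ≤ Module.finrank (ZMod 3) (LinearMap.range Ev) := Submodule.finrank_mono hle
    _ ≤ Module.finrank (ZMod 3) (Module.Dual (ZMod 3) W) := LinearMap.finrank_range_le Ev
    _ = _ := Subspace.dual_finrank_eq

/-- low digit -/
def dig1 : ZMod 9 →+ ZMod 3 :=
  AddMonoidHom.mk' (fun θ => ((θ.val % 3 : ℕ) : ZMod 3)) (by decide)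

/-- high digit -/
def dig2 (θ : ZMod 9) : ZMod 3 := ((θ.val / 3 : ℕ) : ZMod 3)

lemma gray3_eq (θ : ZMod 9) (i : Fin 3) : gray3 θ i = dig2 θ + dig1 θ * ((i : ℕ) : ZMod 3) := rfl

lemma dig2_add : ∀ a b : ZMod 9, dig2 (a + b) = dig2 a + dig2 b +
    2 * (dig1 a * dig1 b + dig1 a * dig1 a * dig1 b + dig1 a * dig1 b * dig1 b) := by
  decide

lemma dig2_nsmul : ∀ (l : ZMod 3) (v : ZMod 9), dig2 (l.val • v) =
    (2 * dig2 v - dig2 (2 • v)) * (l * l) + (dig2 (2 • v) - dig2 v) * (l * l * l) := by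
  decide

lemma dig2_add_tors : ∀ a b : ZMod 9, 3 • a = 0 → dig2 (a + b) = dig2 a + dig2 b := by
  decide

lemma dig1_tors : ∀ a : ZMod 9, 3 • a = 0 ↔ dig1 a = 0 := by
  decide

lemma dig_inj : ∀ a b : ZMod 9, dig1 a = dig1 b → dig2 a = dig2 b → a = b := by
  decide

lemma gray3_inj : Function.Injective gray3 := by
  intro a b h
  have h0 := congrFun h 0
  have h1 := congrFun h 1
  simp only [gray3_eq] at h0 h1
  simp at h0 h1
  rw [h0] at h1
  exact dig_inj a b (by simpa using h1) h0

lemma Gray3_inj (α β : ℕ) : Function.Injective (Gray3 α β) := by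
  rintro ⟨x, y⟩ ⟨x', y'⟩ h
  simp only [Gray3, Prod.mk.injEq] at h
  obtain ⟨h1, h2⟩ := h
  subst h1
  congr 1
  funext j
  exact gray3_inj (congrFun h2 j)

lemma Gray3_add_s16 (α β : ℕ) (t u : (Fin α → ZMod 3) × (Fin β → ZMod 9)) (ht : 3 • t = 0) :
    Gray3 α β (t + u) = Gray3 α β t + Gray3 α β u := by
  refine Prod.ext rfl ?_
  funext j i
  have h : 3 • t.2 j = 0 := congrFun (congrArg Prod.snd ht) j
  change gray3 (t.2 j + u.2 j) i = gray3 (t.2 j) i + gray3 (u.2 j) i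
  simp only [gray3_eq, dig2_add_tors _ (u.2 j) h, map_add]
  ring

lemma card_sub {V : Type*} [AddCommGroup V] [Module (ZMod 3) V] [Finite V]
    (S : Submodule (ZMod 3) V) : Nat.card S = 3 ^ Module.finrank (ZMod 3) S := by
  rw [Module.natCard_eq_pow_finrank (K := ZMod 3), Nat.card_zmod]

lemma coe_span_addSubgroup {V : Type*} [AddCommGroup V] [Module (ZMod 3) V]
    (S : AddSubgroup V) : Nat.card (Submodule.span (ZMod 3) (S : Set V)) = Nat.card S := by
  have : Submodule.span (ZMod 3) (S : Set V) = AddSubgroup.toZModSubmodule 3 S := by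
    apply le_antisymm
    · rw [Submodule.span_le]; exact fun x hx => hx
    · intro x hx; exact Submodule.subset_span hx
  rw [this]
  rfl

/-- the torsion part of a group -/
def tors3 (G : Type*) [AddCommGroup G] : AddSubgroup G := (nsmulAddMonoidHom 3 : G →+ G).ker

lemma mem_tors3 {G : Type*} [AddCommGroup G] (g : G) : g ∈ tors3 G ↔ 3 • g = 0 := Iff.rfl

lemma card_tors3 (γ δ : ℕ) :
    Nat.card (tors3 ((Fin γ → ZMod 3) × (Fin δ → ZMod 9))) = 3 ^ (γ + δ) := by
  have e : tors3 ((Fin γ → ZMod 3) × (Fin δ → ZMod 9)) ≃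
      (Fin γ → ZMod 3) × (Fin δ → {a : ZMod 9 // 3 • a = 0}) :=
    { toFun := fun t => (t.1.1, fun i => ⟨t.1.2 i, congrFun (congrArg Prod.snd t.2) i⟩)
      invFun := fun p => ⟨(p.1, fun i => (p.2 i).1), by
        rw [mem_tors3]
        refine Prod.ext ?_ ?_
        · funext i
          exact (by decide : ∀ x : ZMod 3, 3 • x = 0) _
        · funext i
          exact (p.2 i).2⟩
      left_inv := fun t => rfl
      right_inv := fun p => rfl }
  have h3 : Nat.card {a : ZMod 9 // 3 • a = 0} = 3 := by
    rw [Nat.card_eq_fintype_card]; decide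
  rw [Nat.card_congr e, Nat.card_prod, Nat.card_fun, Nat.card_fun, h3]
  simp [pow_add]

/-- The polynomial part. -/
lemma poly_part (α β δ : ℕ) (v : Fin δ → (Fin α → ZMod 3) × (Fin β → ZMod 9)) :
    Module.finrank (ZMod 3) (Submodule.span (ZMod 3)
      (Set.range fun l : Fin δ → ZMod 3 => Gray3 α β (∑ i, (l i).val • v i))) ≤
      Nat.multichoose δ 2 + Nat.multichoose δ 3 := by
  classical
  let x : Fin δ → ((Fin δ → ZMod 3) → ZMod 3) := fun i l => l i
  let L := Submodule.span (ZMod 3) (Set.range x)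
  have hx : ∀ i, x i ∈ L := fun i => Submodule.subset_span ⟨i, rfl⟩
  have m2 : ∀ {a b}, a ∈ L → b ∈ L → a * b ∈ L ^ 2 ⊔ L ^ 3 := by
    intro a b ha hb
    refine Submodule.mem_sup_left ?_
    rw [pow_two]
    exact Submodule.mul_mem_mul ha hb
  have m3 : ∀ {a b c}, a ∈ L → b ∈ L → c ∈ L → a * b * c ∈ L ^ 2 ⊔ L ^ 3 := by
    intro a b c ha hb hc
    refine Submodule.mem_sup_right ?_
    rw [pow_succ, pow_two]
    exact Submodule.mul_mem_mul (Submodule.mul_mem_mul ha hb) hc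
  have hL : L ≤ L ^ 2 ⊔ L ^ 3 := by
    refine Submodule.span_le.2 ?_
    rintro _ ⟨i, rfl⟩
    have : x i = x i * x i * x i := by
      funext l
      exact (by decide : ∀ a : ZMod 3, a = a * a * a) _
    rw [this]
    exact m3 (hx i) (hx i) (hx i)
  have lin : ∀ (s : Finset (Fin δ)) (c : Fin δ → ZMod 3),
      (fun l : Fin δ → ZMod 3 => ∑ i ∈ s, (l i).val • c i) ∈ L := by
    intro s c
    have : (fun l : Fin δ → ZMod 3 => ∑ i ∈ s, (l i).val • c i) = ∑ i ∈ s, c i • x i := by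
      funext l
      simp [x, mul_comm]
    rw [this]
    exact Submodule.sum_mem _ fun i _ => Submodule.smul_mem _ _ (hx i)
  have d1 : ∀ (s : Finset (Fin δ)) (c : Fin δ → ZMod 9),
      (fun l : Fin δ → ZMod 3 => dig1 (∑ i ∈ s, (l i).val • c i)) ∈ L := by
    intro s c
    simp only [map_sum, map_nsmul]
    exact lin s _
  have d2 : ∀ (s : Finset (Fin δ)) (c : Fin δ → ZMod 9),
      (fun l : Fin δ → ZMod 3 => dig2 (∑ i ∈ s, (l i).val • c i)) ∈ L ^ 2 ⊔ L ^ 3 := by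
    intro s c
    induction s using Finset.induction_on with
    | empty =>
      have : (fun l : Fin δ → ZMod 3 => dig2 (∑ i ∈ ∅, (l i).val • c i)) = 0 := by
        funext l
        simp [dig2]
      rw [this]
      exact Submodule.zero_mem _
    | insert j s hj ih =>
      have hb := d1 {j} c
      have ha := d1 s c
      simp only [Finset.sum_singleton] at hb
      have hsingle : (fun l : Fin δ → ZMod 3 => dig2 ((l j).val • c j)) ∈ L ^ 2 ⊔ L ^ 3 := by
        have : (fun l : Fin δ → ZMod 3 => dig2 ((l j).val • c j)) =
            (2 * dig2 (c j) - dig2 (2 • c j)) • (x j * x j) +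
              (dig2 (2 • c j) - dig2 (c j)) • (x j * x j * x j) := by
          funext l
          exact dig2_nsmul _ _
        rw [this]
        exact Submodule.add_mem _ (Submodule.smul_mem _ _ (m2 (hx j) (hx j)))
          (Submodule.smul_mem _ _ (m3 (hx j) (hx j) (hx j)))
      have key := Submodule.add_mem _ (Submodule.add_mem _ hsingle ih)
        (Submodule.smul_mem _ (2 : ZMod 3) (Submodule.add_mem _
          (Submodule.add_mem _ (m2 hb ha) (m3 hb hb ha)) (m3 hb ha ha)))
      convert key using 1
      funext l
      rw [Finset.sum_insert hj]
      exact dig2_add _ _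
  refine (finrank_span_range_le _ (L ^ 2 ⊔ L ^ 3) ?_ ?_).trans ?_
  · intro a
    have := hL (lin Finset.univ fun i => (v i).1 a)
    convert this using 1
    funext l
    simp only [Gray3, Prod.fst_sum, Finset.sum_apply]
    rfl
  · intro b c
    have h1 := hL (d1 Finset.univ fun i => (v i).2 b)
    have h2 := d2 Finset.univ fun i => (v i).2 b
    have := Submodule.add_mem _ h2 (Submodule.smul_mem _ (((c : ℕ) : ZMod 3)) h1)
    convert this using 1
    funext l
    have : (∑ i, (l i).val • v i).2 b = ∑ i, (l i).val • (v i).2 b := by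
      simp only [Prod.snd_sum, Finset.sum_apply]
      rfl
    change gray3 ((∑ i, (l i).val • v i).2 b) c = _
    rw [this, gray3_eq, mul_comm (dig1 _)]
    rfl
  · exact (Submodule.finrank_add_le_finrank_add_finrank _ _).trans
      (add_le_add (finrank_span_pow_le δ 2 x) (finrank_span_pow_le δ 3 x))

/-- Bounds on the rank of a `Z₃Z₉`-linear code of type `(α, β; γ, δ; κ)`. -/
theorem rank_bounds (α β γ δ κ : ℕ)
    (h1 : α + β > 0) (h2 : 0 < γ + δ) (h3 : γ + δ ≤ β + κ) (h4 : κ ≤ min α γ)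
    (𝒞 : AddSubgroup ((Fin α → ZMod 3) × (Fin β → ZMod 9)))
    (e : 𝒞 ≃+ (Fin γ → ZMod 3) × (Fin δ → ZMod 9))
    (hκ : kappa3 α β 𝒞 = κ) :
    γ + 2 * δ ≤
        Module.finrank (ZMod 3)
          (Submodule.span (ZMod 3)
            (Gray3 α β '' (𝒞 : Set ((Fin α → ZMod 3) × (Fin β → ZMod 9))))) ∧
      Module.finrank (ZMod 3)
          (Submodule.span (ZMod 3)
            (Gray3 α β '' (𝒞 : Set ((Fin α → ZMod 3) × (Fin β → ZMod 9))))) ≤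
        γ + 2 * δ +
          min (β - (γ - κ) - δ)
            (Nat.choose (δ + 1) 2 + Nat.choose (δ + 2) 3 - δ) := by
  classical
  let A := (Fin α → ZMod 3) × (Fin β → ZMod 9)
  let G := (Fin γ → ZMod 3) × (Fin δ → ZMod 9)
  let f : G →+ A := 𝒞.subtype.comp e.symm.toAddMonoidHom
  have hfinj : Function.Injective f := Subtype.val_injective.comp e.symm.injective
  have hfmem : ∀ g, f g ∈ 𝒞 := fun g => (e.symm g).2
  have hfsurj : ∀ u ∈ 𝒞, ∃ g, f g = u := fun u hu => ⟨e ⟨u, hu⟩, by simp [f]⟩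
  have hcard : Nat.card 𝒞 = 3 ^ (γ + 2 * δ) := by
    rw [Nat.card_congr e.toEquiv, Nat.card_prod, Nat.card_fun, Nat.card_fun]
    simp only [Nat.card_zmod, Nat.card_fin]
    rw [pow_add, pow_mul]
    norm_num
  -- torsion subgroup of the code
  let T : AddSubgroup A := (tors3 G).map f
  have hTmem : ∀ u, u ∈ T ↔ u ∈ 𝒞 ∧ 3 • u = 0 := by
    intro u
    constructor
    · rintro ⟨g, hg, rfl⟩
      refine ⟨hfmem g, ?_⟩
      rw [← map_nsmul, (mem_tors3 g).1 hg, map_zero]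
    · rintro ⟨hu, h⟩
      obtain ⟨g, rfl⟩ := hfsurj u hu
      refine ⟨g, ?_, rfl⟩
      apply hfinj
      rw [map_zero, ← h]
      exact map_nsmul f 3 g
  have hTcard : Nat.card T = 3 ^ (γ + δ) := by
    rw [← card_tors3]
    exact (Nat.card_congr ((tors3 G).equivMapOfInjective f hfinj).toEquiv).symm
  have lower : γ + 2 * δ ≤ Module.finrank (ZMod 3)
      (Submodule.span (ZMod 3) (Gray3 α β '' (𝒞 : Set A))) := by
    rw [← Nat.pow_le_pow_iff_right (a := 3) (by norm_num), ← card_sub, ← hcard]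
    rw [show Nat.card 𝒞 = Nat.card (Gray3 α β '' (𝒞 : Set A)) from
      (Nat.card_image_of_injective (Gray3_inj α β) _).symm]
    exact Nat.card_mono (Set.toFinite _) Submodule.subset_span
  refine ⟨lower, ?_⟩
  have upper1 : Module.finrank (ZMod 3)
      (Submodule.span (ZMod 3) (Gray3 α β '' (𝒞 : Set A))) ≤ (δ + κ) + β := by
    let ρ : A →+ (Fin α → ZMod 3) × (Fin β → ZMod 3) :=
      AddMonoidHom.prodMap (AddMonoidHom.id _) (dig1.compLeft (Fin β))
    let ρC := ρ.comp 𝒞.subtype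
    let p : T →+ (Fin α → ZMod 3) := (AddMonoidHom.fst _ _).comp T.subtype
    have c1 : Nat.card 𝒞 = Nat.card ρC.range * Nat.card ρC.ker := by
      rw [AddSubgroup.card_eq_card_quotient_mul_card_addSubgroup ρC.ker,
        Nat.card_congr (QuotientAddGroup.quotientKerEquivRange ρC).toEquiv]
    have c2 : Nat.card T = Nat.card p.range * Nat.card p.ker := by
      rw [AddSubgroup.card_eq_card_quotient_mul_card_addSubgroup p.ker,
        Nat.card_congr (QuotientAddGroup.quotientKerEquivRange p).toEquiv]
    have htor : ∀ u : A, ρ u = 0 ↔ (3 • u = 0 ∧ u.1 = 0) := by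
      intro u
      constructor
      · intro h
        have ha : u.1 = 0 := congrArg Prod.fst h
        have hb : ∀ j, dig1 (u.2 j) = 0 := fun j => congrFun (congrArg Prod.snd h) j
        refine ⟨Prod.ext ?_ ?_, ha⟩
        · change 3 • u.1 = 0
          rw [ha, smul_zero]
        · funext j
          exact (dig1_tors _).2 (hb j)
      · rintro ⟨h, ha⟩
        refine Prod.ext ha ?_
        funext j
        exact (dig1_tors _).1 (congrFun (congrArg Prod.snd h) j)
    have c3 : Nat.card ρC.ker = Nat.card p.ker := by
      refine Nat.card_congr
        { toFun := fun u => ⟨⟨u.1.1, (hTmem _).2 ⟨u.1.2, ((htor _).1 u.2).1⟩⟩, ((htor _).1 u.2).2⟩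
          invFun := fun u => ⟨⟨u.1.1, ((hTmem _).1 u.1.2).1⟩,
            (htor _).2 ⟨((hTmem _).1 u.1.2).2, u.2⟩⟩
          left_inv := fun _ => rfl
          right_inv := fun _ => rfl }
    have c4 : Nat.card p.range = 3 ^ κ := by
      have hset : (p.range : Set (Fin α → ZMod 3)) =
          Prod.fst '' {u : (Fin α → ZMod 3) × (Fin β → ZMod 9) | u ∈ 𝒞 ∧ 3 • u = 0} := by
        ext x
        constructor
        · rintro ⟨u, rfl⟩
          exact ⟨u.1, (hTmem _).1 u.2, rfl⟩
        · rintro ⟨u, hu, rfl⟩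
          exact ⟨⟨u, (hTmem _).2 hu⟩, rfl⟩
      rw [← coe_span_addSubgroup, card_sub, ← hκ, kappa3, hset]
    have c5 : Nat.card ρC.range = 3 ^ (δ + κ) := by
      rw [hcard, c3] at c1
      rw [hTcard, c4] at c2
      have hpos : 0 < Nat.card p.ker := Nat.card_pos
      apply Nat.eq_of_mul_eq_mul_right hpos
      rw [← c1, pow_add 3 δ κ, mul_assoc, ← c2]
      ring
    let I := AddSubgroup.toZModSubmodule 3 ρC.range
    have hI : Module.finrank (ZMod 3) I = δ + κ := by
      have : Nat.card I = 3 ^ (δ + κ) := c5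
      rw [card_sub] at this
      exact Nat.pow_right_injective (le_refl 2 |>.trans (by norm_num)) this
    let ψ : (I × (Fin β → ZMod 3)) →ₗ[ZMod 3] (Fin α → ZMod 3) × (Fin β → Fin 3 → ZMod 3) :=
      { toFun := fun q => (q.1.1.1, fun j i => q.2 j + q.1.1.2 j * ((i : ℕ) : ZMod 3))
        map_add' := by
          intro q r
          refine Prod.ext rfl ?_
          funext j i
          simp
          ring
        map_smul' := by
          intro c q
          refine Prod.ext rfl ?_
          funext j i
          simp
          ring }
    have hle : Submodule.span (ZMod 3) (Gray3 α β '' (𝒞 : Set A)) ≤ LinearMap.range ψ := by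
      rw [Submodule.span_le]
      rintro _ ⟨u, hu, rfl⟩
      exact ⟨(⟨ρ u, ⟨⟨u, hu⟩, rfl⟩⟩, fun j => dig2 (u.2 j)), rfl⟩
    calc _ ≤ _ := Submodule.finrank_mono hle
      _ ≤ _ := LinearMap.finrank_range_le ψ
      _ = _ := by rw [Module.finrank_prod, hI, Module.finrank_fin_fun]
  have upper2 : Module.finrank (ZMod 3)
      (Submodule.span (ZMod 3) (Gray3 α β '' (𝒞 : Set A))) ≤
      (γ + δ) + (Nat.multichoose δ 2 + Nat.multichoose δ 3) := by
    let w : Fin δ → G := fun i => (0, Pi.single i 1)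
    let v : Fin δ → A := fun i => f (w i)
    let GT : T →+ (Fin α → ZMod 3) × (Fin β → Fin 3 → ZMod 3) :=
      AddMonoidHom.mk' (fun t => Gray3 α β t.1)
        (fun t u => Gray3_add_s16 α β t.1 u.1 ((hTmem _).1 t.2).2)
    have hGTcard : Nat.card GT.range = 3 ^ (γ + δ) := by
      rw [← hTcard]
      exact (Nat.card_congr (AddMonoidHom.ofInjective (f := GT)
        ((Gray3_inj α β).comp Subtype.val_injective)).toEquiv).symm
    let S := AddSubgroup.toZModSubmodule 3 GT.range
    have hS : Module.finrank (ZMod 3) S = γ + δ := by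
      have : Nat.card S = 3 ^ (γ + δ) := hGTcard
      rw [card_sub] at this
      exact Nat.pow_right_injective (le_refl 2 |>.trans (by norm_num)) this
    let P := Submodule.span (ZMod 3)
      (Set.range fun l : Fin δ → ZMod 3 => Gray3 α β (∑ i, (l i).val • v i))
    have hle : Submodule.span (ZMod 3) (Gray3 α β '' (𝒞 : Set A)) ≤ S ⊔ P := by
      rw [Submodule.span_le]
      rintro _ ⟨u, hu, rfl⟩
      obtain ⟨g, rfl⟩ := hfsurj u hu
      let l : Fin δ → ZMod 3 := fun i => dig1 (g.2 i)
      let t : G := g - ∑ i, (l i).val • w i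
      have hw1 : (∑ i, (l i).val • w i).2 = fun i => (((l i).val : ℕ) : ZMod 9) := by
        funext j
        have h : (∑ i, (l i).val • w i).2 j =
            ∑ i, (l i).val • (Pi.single i 1 : Fin δ → ZMod 9) j := by
          rw [Prod.snd_sum, Finset.sum_apply]
          rfl
        rw [h]
        simp only [Pi.single_apply, nsmul_eq_mul, mul_ite, mul_one, mul_zero,
          Finset.sum_ite_eq, Finset.mem_univ, if_true]
      have ht : t ∈ tors3 G := by
        rw [mem_tors3]
        refine Prod.ext ?_ ?_
        · funext i
          exact (by decide : ∀ x : ZMod 3, 3 • x = 0) _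
        · funext i
          change 3 • (g.2 i - (∑ i, (l i).val • w i).2 i) = 0
          rw [hw1]
          exact (by decide : ∀ x : ZMod 9, 3 • (x - (((dig1 x).val : ℕ) : ZMod 9)) = 0) _
      have hg : f g = f t + ∑ i, (l i).val • v i := by
        have : g = t + ∑ i, (l i).val • w i := by simp [t]
        conv_lhs => rw [this]
        simp only [map_add, map_sum, map_nsmul, v]
      have hfT : f t ∈ T := ⟨t, ht, rfl⟩
      rw [hg, Gray3_add_s16 α β _ _ ((hTmem _).1 hfT).2]
      exact Submodule.add_mem_sup ⟨⟨f t, hfT⟩, rfl⟩ (Submodule.subset_span ⟨l, rfl⟩)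
    calc _ ≤ _ := Submodule.finrank_mono hle
      _ ≤ _ := Submodule.finrank_add_le_finrank_add_finrank _ _
      _ ≤ _ := add_le_add hS.le (poly_part α β δ v)
  have hm2 : Nat.multichoose δ 2 = Nat.choose (δ + 1) 2 := by
    rw [Nat.multichoose_eq]; rfl
  have hm3 : Nat.multichoose δ 3 = Nat.choose (δ + 2) 3 := by
    rw [Nat.multichoose_eq]; rfl
  rw [hm2, hm3] at upper2
  have h5 : κ ≤ γ := h4.trans (min_le_right _ _)
  omega
end
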